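/- Let K : [0,T] → ℝ be nonnegative, non-increasing, continuous and square-integrable on [0,T]. Let (π_n)_{n≥1} be a sequence of partitions of [0,T] with mesh |π_n| → 0 and associated step functions η_n, and let z^n → z in C([0,T],ℝ) for the uniform norm. Then lim_{n→∞} sup_{t ∈ [0,T]} | ∫_0^t K(t − η_n(s)) z^n(s) ds − ∫_0^t K(t − s) z(s) ds | = 0. -/

import Mathlib

open MeasureTheory Set Filter

/-- A partition `0 = t_0 < t_1 < ... < t_n = T` of the interval `[0,T]`. -/
structure TimeGrid (T : ℝ) where
  n : ℕ
  t : ℕ → ℝ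
  npos : 0 < n
  first : t 0 = 0
  last : t n = T
  strict : ∀ i < n, t i < t (i + 1)

/-- The step function `η` associated to a partition: `η(s) = t_k` for `s ∈ [t_k, t_{k+1})`,
`η(T) = T`. -/
noncomputable def TimeGrid.eta {T : ℝ} (π : TimeGrid T) (s : ℝ) : ℝ :=
  sSup {x | ∃ k ≤ π.n, π.t k = x ∧ x ≤ s}

/-- The mesh of a partition. -/
noncomputable def TimeGrid.mesh {T : ℝ} (π : TimeGrid T) : ℝ :=
  sSup {d | ∃ k < π.n, d = π.t (k + 1) - π.t k}

namespace TimeGrid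

variable {T : ℝ}

theorem le_eta (π : TimeGrid T) {k : ℕ} {s : ℝ} (hk : k ≤ π.n) (hs : π.t k ≤ s) :
    π.t k ≤ π.eta s :=
  le_csSup ⟨s, fun _ ⟨_, _, _, hx⟩ => hx⟩ ⟨k, hk, rfl, hs⟩

theorem eta_nonneg (π : TimeGrid T) {s : ℝ} (hs : 0 ≤ s) : 0 ≤ π.eta s := by
  simpa [π.first] using π.le_eta (Nat.zero_le π.n) (π.first.trans_le hs)

theorem eta_le (π : TimeGrid T) {s : ℝ} (hs : 0 ≤ s) : π.eta s ≤ s :=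
  csSup_le ⟨0, 0, Nat.zero_le _, π.first, hs⟩ fun _ ⟨_, _, _, hx⟩ => hx

theorem monotoneOn_eta (π : TimeGrid T) : MonotoneOn π.eta (Set.Ici 0) := by
  intro s hs u _ hsu
  refine csSup_le ⟨0, 0, Nat.zero_le _, π.first, hs⟩ ?_
  rintro _ ⟨k, hk, rfl, hks⟩
  exact π.le_eta hk (hks.trans hsu)

theorem sub_le_mesh (π : TimeGrid T) {k : ℕ} (hk : k < π.n) :
    π.t (k + 1) - π.t k ≤ π.mesh := by
  refine le_csSup (Set.Finite.bddAbove ?_) ⟨k, hk, rfl⟩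
  refine ((Set.finite_Iio π.n).image fun k => π.t (k + 1) - π.t k).subset ?_
  rintro _ ⟨j, hj, rfl⟩
  exact ⟨j, hj, rfl⟩

theorem exists_mem_Icc (π : TimeGrid T) {s : ℝ} (hs : s ∈ Set.Icc 0 T) :
    ∃ k < π.n, s ∈ Set.Icc (π.t k) (π.t (k + 1)) := by
  have key : ∀ m : ℕ, s ≤ π.t (m + 1) → ∃ k ≤ m, s ∈ Set.Icc (π.t k) (π.t (k + 1)) := by
    intro m
    induction m with
    | zero => exact fun h => ⟨0, le_rfl, π.first.trans_le hs.1, h⟩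
    | succ m ih =>
      intro h
      rcases le_total s (π.t (m + 1)) with h' | h'
      · obtain ⟨k, hk, hks⟩ := ih h'
        exact ⟨k, hk.trans m.le_succ, hks⟩
      · exact ⟨m + 1, le_rfl, h', h⟩
  have hn := π.npos
  obtain ⟨k, hk, hks⟩ := key (π.n - 1) (by
    rw [Nat.sub_add_cancel hn, π.last]
    exact hs.2)
  exact ⟨k, by omega, hks⟩

theorem sub_eta_le_mesh (π : TimeGrid T) {s : ℝ} (hs : s ∈ Set.Icc 0 T) :
    s - π.eta s ≤ π.mesh := by
  obtain ⟨k, hk, hks⟩ := π.exists_mem_Icc hs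
  linarith [π.le_eta hk.le hks.1, π.sub_le_mesh hk, hks.2]

end TimeGrid


/-- Lemma `convOFz`: for a nonnegative, non-increasing, continuous, square-integrable
kernel `K` on `[0,T]`, if `zⁿ → z` uniformly on `[0,T]` and the mesh of the partitions tends
to `0`, then `∫_0^t K(t-η_n(s)) zⁿ(s) ds → ∫_0^t K(t-s) z(s) ds` uniformly in `t ∈ [0,T]`. -/
theorem discretized_convolution_uniform_convergence
    {T : ℝ} (hT : 0 < T) (K : ℝ → ℝ)
    (hK0 : ∀ u ∈ Set.Icc (0:ℝ) T, 0 ≤ K u)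
    (hKmono : ∀ u ∈ Set.Icc (0:ℝ) T, ∀ v ∈ Set.Icc (0:ℝ) T, u ≤ v → K v ≤ K u)
    (hKcont : ContinuousOn K (Set.Icc 0 T))
    (hKL2 : IntegrableOn (fun u => K u ^ 2) (Set.Icc 0 T))
    (π : ℕ → TimeGrid T)
    (hmesh : Filter.Tendsto (fun n => (π n).mesh) Filter.atTop (nhds 0))
    (zn : ℕ → C(Set.Icc (0:ℝ) T, ℝ)) (z : C(Set.Icc (0:ℝ) T, ℝ))
    (hzn : Filter.Tendsto zn Filter.atTop (nhds z)) :
    ∀ ε > 0, ∃ N : ℕ, ∀ n ≥ N, ∀ t ∈ Set.Icc (0:ℝ) T,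
      |(∫ s in (0:ℝ)..t, K (t - (π n).eta s) * zn n (Set.projIcc 0 T hT.le s))
        - ∫ s in (0:ℝ)..t, K (t - s) * z (Set.projIcc 0 T hT.le s)| < ε := by
  intro ε hε
  have hK00 : 0 ≤ K 0 := hK0 0 ⟨le_rfl, hT.le⟩
  have hC : 0 < K 0 + ‖z‖ + 1 := by positivity
  obtain ⟨δ, hδ, hδε⟩ : ∃ δ > 0, δ * (K 0 + ‖z‖) * T < ε := by
    refine ⟨ε / ((K 0 + ‖z‖ + 1) * T), by positivity, ?_⟩
    rw [div_mul_eq_mul_div, div_mul_eq_mul_div, div_lt_iff₀ (by positivity)]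
    nlinarith [mul_pos hε hT]
  obtain ⟨ρ, hρ, hKρ⟩ := Metric.uniformContinuousOn_iff.1
    (isCompact_Icc.uniformContinuousOn_of_continuous hKcont) δ hδ
  obtain ⟨N, hN⟩ := eventually_atTop.1
    ((hmesh.eventually_lt_const hρ).and (Metric.tendsto_nhds.1 hzn δ hδ))
  refine ⟨N, fun n hn t ht => ?_⟩
  obtain ⟨hmeshn, hznn⟩ := hN n hn
  have hcont (f : C(Set.Icc (0:ℝ) T, ℝ)) :
      ContinuousOn (fun s => f (Set.projIcc 0 T hT.le s)) (Set.uIcc 0 t) :=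
    (f.continuous.comp continuous_projIcc).continuousOn
  have hmem {s : ℝ} (hs : s ∈ Set.Icc 0 t) : t - s ∈ Set.Icc 0 T :=
    ⟨by linarith [hs.2], by linarith [hs.1, ht.2]⟩
  have hmem_eta {s : ℝ} (hs : s ∈ Set.Icc 0 t) : t - (π n).eta s ∈ Set.Icc 0 T :=
    hmem ⟨(π n).eta_nonneg hs.1, ((π n).eta_le hs.1).trans hs.2⟩
  have hint_eta : IntervalIntegrable
      (fun s => K (t - (π n).eta s) * zn n (Set.projIcc 0 T hT.le s)) volume 0 t := by
    refine IntervalIntegrable.mul_continuousOn (MonotoneOn.intervalIntegrable ?_) (hcont _)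
    rw [Set.uIcc_of_le ht.1]
    intro s hs u hu hsu
    exact hKmono _ (hmem_eta hu) _ (hmem_eta hs)
      (by linarith [(π n).monotoneOn_eta hs.1 hu.1 hsu])
  have hint : IntervalIntegrable
      (fun s => K (t - s) * z (Set.projIcc 0 T hT.le s)) volume 0 t := by
    refine IntervalIntegrable.mul_continuousOn (MonotoneOn.intervalIntegrable ?_) (hcont _)
    rw [Set.uIcc_of_le ht.1]
    intro s hs u hu hsu
    exact hKmono _ (hmem hu) _ (hmem hs) (by linarith)
  rw [← intervalIntegral.integral_sub hint_eta hint, ← Real.norm_eq_abs]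
  refine (intervalIntegral.norm_integral_le_of_norm_le_const
    (C := δ * (K 0 + ‖z‖)) fun s hs => ?_).trans_lt ?_
  · rw [Set.uIoc_of_le ht.1] at hs
    have hs' : s ∈ Set.Icc 0 t := ⟨hs.1.le, hs.2⟩
    set x := Set.projIcc 0 T hT.le s
    have hz : |zn n x - z x| ≤ δ := by
      rw [← Real.dist_eq]
      exact (ContinuousMap.dist_apply_le_dist x).trans hznn.le
    have hzx : |z x| ≤ ‖z‖ := z.norm_coe_le_norm x
    have hKd : |K (t - (π n).eta s) - K (t - s)| ≤ δ := by
      rw [← Real.dist_eq]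
      refine (hKρ _ (hmem_eta hs') _ (hmem hs') ?_).le
      rw [Real.dist_eq, sub_sub_sub_cancel_left, abs_of_nonneg (sub_nonneg.2 ((π n).eta_le hs'.1))]
      exact ((π n).sub_eta_le_mesh ⟨hs'.1, hs'.2.trans ht.2⟩).trans_lt hmeshn
    have hKb : |K (t - (π n).eta s)| ≤ K 0 := by
      rw [abs_of_nonneg (hK0 _ (hmem_eta hs'))]
      exact hKmono 0 ⟨le_rfl, hT.le⟩ _ (hmem_eta hs') (hmem_eta hs').1
    calc ‖K (t - (π n).eta s) * zn n x - K (t - s) * z x‖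
        = |K (t - (π n).eta s) * (zn n x - z x)
            + (K (t - (π n).eta s) - K (t - s)) * z x| := by
          rw [Real.norm_eq_abs]
          ring_nf
      _ ≤ |K (t - (π n).eta s)| * |zn n x - z x|
            + |K (t - (π n).eta s) - K (t - s)| * |z x| := by
          rw [← abs_mul, ← abs_mul]
          exact abs_add_le _ _
      _ ≤ K 0 * δ + δ * ‖z‖ := by gcongr
      _ = δ * (K 0 + ‖z‖) := by ring
  · rw [sub_zero, abs_of_nonneg ht.1]
    refine lt_of_le_of_lt ?_ hδε
    gcongr
    exact ht.2
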